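/- arXiv:0908.2399 — 10 statements merged into one kernel-verified Lean document; each statement's English description precedes it below -/
import Mathlib

section
/- Let G^0, G^1, G^2, … be a sequence of restrictions of a strategic game such that G^0 = (S_1,…,S_n) is the full game and sd^g(G^k) ⊆ G^{k+1} ⊆ G^k (componentwise inclusion) for all k ≥ 0. Then for all k ≥ 0, sd^g(G^k) = sd^ℓ(G^k). -/
open scoped Classical

/-- The joint strategies of the opponents of player `i`. -/
abbrev Opp {n : ℕ} (S : Fin n → Type) (i : Fin n) := ∀ j, j ≠ i → S j

/-- A strategic game (with parametrized preferences): for each player `i` and each joint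
strategy of the opponents, an irreflexive and transitive strict preference relation on `S i`. -/
structure Game (n : ℕ) (S : Fin n → Type) where
  pref : ∀ i : Fin n, Opp S i → S i → S i → Prop
  irrefl : ∀ (i : Fin n) (sOpp : Opp S i) (si : S i), ¬ pref i sOpp si si
  trans : ∀ (i : Fin n) (sOpp : Opp S i) (a b c : S i),
    pref i sOpp a b → pref i sOpp b c → pref i sOpp a c

variable {n : ℕ} {S : Fin n → Type}

/-- A restriction of the game: a family of subsets of the strategy sets. -/
abbrev Restriction (S : Fin n → Type) := ∀ i, Set (S i)

/-- The full game, as a restriction. -/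
def fullR (S : Fin n → Type) : Restriction S := fun _ => Set.univ

/-- Componentwise inclusion of restrictions. -/
def RestrLE (R R' : Restriction S) : Prop := ∀ i, R i ⊆ R' i

/-- `sOpp` is a joint strategy of the opponents of `i` inside the restriction `R`. -/
def inOpp (R : Restriction S) {i : Fin n} (sOpp : Opp S i) : Prop :=
  ∀ (j : Fin n) (h : j ≠ i), sOpp j h ∈ R j

/-- Global strict dominance optimality: `si` is not strictly dominated on `R` by any strategy
from the *initial* game. -/
def sdg (G : Game n S) (R : Restriction S) (i : Fin n) (si : S i) : Prop :=
  ¬ ∃ si' : S i, ∀ sOpp : Opp S i, inOpp R sOpp → G.pref i sOpp si' si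

/-- Local strict dominance optimality: `si` is not strictly dominated on `R` by any strategy
from the restriction `R i`. -/
def sdl (G : Game n S) (R : Restriction S) (i : Fin n) (si : S i) : Prop :=
  ¬ ∃ si' ∈ R i, ∀ sOpp : Opp S i, inOpp R sOpp → G.pref i sOpp si' si

/-- The restriction `sd^g(G')` whose `i`-th component is `{s_i ∈ S'_i | sd^g(s_i, G')}`. -/
def sdgRes (G : Game n S) (R : Restriction S) : Restriction S :=
  fun i => {si ∈ R i | sdg G R i si}

/-- The restriction `sd^ℓ(G')` whose `i`-th component is `{s_i ∈ S'_i | sd^ℓ(s_i, G')}`. -/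
def sdlRes (G : Game n S) (R : Restriction S) : Restriction S :=
  fun i => {si ∈ R i | sdl G R i si}

/-- The elimination operator `T_A` for global strict dominance. -/
def Tg (G : Game n S) (A : Set (Fin n)) (R : Restriction S) : Restriction S :=
  fun i => if i ∈ A then {si ∈ R i | sdg G R i si} else R i

/-- The elimination operator `T_A` for local strict dominance. -/
def Tl (G : Game n S) (A : Set (Fin n)) (R : Restriction S) : Restriction S :=
  fun i => if i ∈ A then {si ∈ R i | sdl G R i si} else R i

/-- `k`-fold iteration of an operator on restrictions, starting at the full game. -/
def iter (T : Restriction S → Restriction S) : ℕ → Restriction S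
  | 0 => fullR S
  | k + 1 => T (iter T k)

/-- The limit `T^∞` of the iterations of `T` starting at the full game. -/
def limit (T : Restriction S → Restriction S) : Restriction S :=
  fun i => ⋂ k, iter T k i

/-- The outcome `G(H)` of iterated elimination with respect to a hypergraph `H`
(global strict dominance): its `i`-th component is `(T_{{i}}(⋂_{A : i ∈ A ∈ H} T_A^∞))_i`. -/
def outcomeG (G : Game n S) (H : Set (Set (Fin n))) : Restriction S :=
  fun i => Tg G {i} (fun j => ⋂ A ∈ {A : Set (Fin n) | i ∈ A ∧ A ∈ H}, limit (Tg G A) j) i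

/-- The outcome `G(H)` of iterated elimination with respect to a hypergraph `H`
(local strict dominance). -/
def outcomeL (G : Game n S) (H : Set (Set (Fin n))) : Restriction S :=
  fun i => Tl G {i} (fun j => ⋂ A ∈ {A : Set (Fin n) | i ∈ A ∧ A ∈ H}, limit (Tl G A) j) i

/-- If `G^0 = (S_1,…,S_n)` and `sd^g(G^k) ⊆ G^{k+1} ⊆ G^k` for all `k`, then
for all `k`, `sd^g(G^k) = sd^ℓ(G^k)`. -/
theorem sdg_eq_sdl_on_sequence {n : ℕ} {S : Fin n → Type}
    (hn : 1 < n) [∀ i, Fintype (S i)] [∀ i, Nonempty (S i)]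
    (G : Game n S) (Gk : ℕ → Restriction S)
    (h0 : Gk 0 = fullR S)
    (hlow : ∀ k, RestrLE (sdgRes G (Gk k)) (Gk (k + 1)))
    (hhigh : ∀ k, RestrLE (Gk (k + 1)) (Gk k)) :
    ∀ k, sdgRes G (Gk k) = sdlRes G (Gk k) := by
  have key : ∀ k i (s : S i), ∃ t ∈ Gk k i, t = s ∨
      ∀ sOpp : Opp S i, inOpp (Gk k) sOpp → G.pref i sOpp t s := by
    intro k
    induction k with
    | zero => intro i s; exact ⟨s, by rw [h0]; trivial, Or.inl rfl⟩
    | succ k ih =>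
      intro i
      have hne : ∀ j, ∃ t, t ∈ Gk k j := fun j => by
        obtain ⟨t, ht, _⟩ := ih j (Classical.arbitrary (S j))
        exact ⟨t, ht⟩
      choose f hf using hne
      let r : S i → S i → Prop := fun a b =>
        ∀ sOpp : Opp S i, inOpp (Gk k) sOpp → G.pref i sOpp a b
      have hmono : ∀ sOpp : Opp S i, inOpp (Gk (k+1)) sOpp → inOpp (Gk k) sOpp :=
        fun o ho j h => hhigh k j (ho j h)
      haveI : IsTrans (S i) r :=
        ⟨fun a b c h1 h2 o ho => G.trans i o a b c (h1 o ho) (h2 o ho)⟩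
      haveI : Std.Irrefl r :=
        ⟨fun a h => G.irrefl i _ a (h (fun j _ => f j) (fun j _ => hf j))⟩
      have wf : WellFounded r := Finite.wellFounded_of_trans_of_irrefl r
      intro s
      induction s using wf.induction with
      | _ s ihs =>
        by_cases hs : sdg G (Gk k) i s
        · obtain ⟨t, ht, rfl | hd⟩ := ih i s
          · exact ⟨t, hlow k i ⟨ht, hs⟩, Or.inl rfl⟩
          · exact absurd ⟨t, hd⟩ hs
        · obtain ⟨u, hu⟩ := not_not.mp hs
          obtain ⟨m, hm, rfl | hd⟩ := ihs u hu
          · exact ⟨m, hm, Or.inr fun o ho => hu o (hmono o ho)⟩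
          · exact ⟨m, hm, Or.inr fun o ho =>
              G.trans i o m u s (hd o ho) (hu o (hmono o ho))⟩
  intro k
  funext i
  ext s
  constructor
  · rintro ⟨h1, h2⟩
    exact ⟨h1, fun ⟨t, _, ht⟩ => h2 ⟨t, ht⟩⟩
  · rintro ⟨h1, h2⟩
    refine ⟨h1, fun ⟨u, hu⟩ => ?_⟩
    obtain ⟨t, ht, rfl | hd⟩ := key k i u
    · exact h2 ⟨t, ht, hu⟩
    · exact h2 ⟨t, ht, fun o ho => G.trans i o t u s (hd o ho) (hu o ho)⟩
end

section
/- For every group of players C ⊆ N, the limit of iterating the elimination operator on C with local strict dominance equals the limit with global strict dominance: T_{C,ℓ}^∞ = T_{C,g}^∞. -/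
open scoped Classical

variable {n : ℕ} {S : Fin n → Type}

theorem claim_aux {n : ℕ} {S : Fin n → Type}
    [∀ i, Fintype (S i)] [∀ i, Nonempty (S i)]
    (G : Game n S) (C : Set (Fin n)) (k : ℕ) : ∀ (i : Fin n) (s : S i),
    ∃ t ∈ iter (Tl G C) k i, t = s ∨
      ∀ sOpp : Opp S i, inOpp (iter (Tl G C) k) sOpp → G.pref i sOpp t s := by
  induction k with
  | zero => intro i s; exact ⟨s, trivial, Or.inl rfl⟩
  | succ k ih =>
    intro i s
    have hmono : ∀ j, iter (Tl G C) (k+1) j ⊆ iter (Tl G C) k j := by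
      intro j x hx
      simp only [iter, Tl] at hx
      split_ifs at hx
      · exact hx.1
      · exact hx
    by_cases hi : i ∈ C
    · let D : S i → S i → Prop := fun t u =>
        ∀ sOpp : Opp S i, inOpp (iter (Tl G C) k) sOpp → G.pref i sOpp t u
      have htr : ∀ a b c, D a b → D b c → D a c := fun a b c h1 h2 o ho =>
        G.trans i o a b c (h1 o ho) (h2 o ho)
      have hirr : ∀ a, ¬ D a a := by
        intro a h
        choose f hf _ using fun j => ih j (Classical.arbitrary (S j))
        exact G.irrefl i _ a (h (fun j _ => f j) (fun j _ => hf j))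
      haveI : IsTrans (S i) D := ⟨htr⟩
      haveI : Std.Irrefl D := ⟨hirr⟩
      have hwf : WellFounded D := Finite.wellFounded_of_trans_of_irrefl D
      obtain ⟨t, ⟨ht, hts⟩, hmin⟩ := hwf.has_min
        {t | t ∈ iter (Tl G C) k i ∧ (t = s ∨ D t s)} (ih i s)
      refine ⟨t, ?_, ?_⟩
      · simp only [iter, Tl, if_pos hi]
        refine ⟨ht, ?_⟩
        rintro ⟨u, hu, hut⟩
        refine hmin u ⟨hu, Or.inr ?_⟩ hut
        rcases hts with rfl | h
        · exact hut
        · exact htr _ _ _ hut h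
      · exact hts.imp id fun h o ho => h o fun j hj => hmono j (ho j hj)
    · obtain ⟨t, ht, hts⟩ := ih i s
      refine ⟨t, ?_, hts.imp id fun h o ho => h o fun j hj => hmono j (ho j hj)⟩
      simp only [iter, Tl, if_neg hi]
      exact ht

theorem iter_aux {n : ℕ} {S : Fin n → Type}
    [∀ i, Fintype (S i)] [∀ i, Nonempty (S i)]
    (G : Game n S) (C : Set (Fin n)) (k : ℕ) :
    iter (Tl G C) k = iter (Tg G C) k := by
  induction k with
  | zero => rfl
  | succ k ih =>
    have key : ∀ i s, sdl G (iter (Tl G C) k) i s ↔ sdg G (iter (Tl G C) k) i s := by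
      intro i s
      refine not_congr ⟨fun ⟨u, _, h⟩ => ⟨u, h⟩, ?_⟩
      rintro ⟨u, hu⟩
      obtain ⟨t, ht, rfl | h⟩ := claim_aux G C k i u
      · exact ⟨t, ht, hu⟩
      · exact ⟨t, ht, fun o ho => G.trans i o _ _ _ (h o ho) (hu o ho)⟩
    show Tl G C (iter (Tl G C) k) = Tg G C (iter (Tg G C) k)
    rw [← ih]
    funext i
    simp only [Tl, Tg, key]

/-- For every group `C ⊆ N`, `T_{C,ℓ}^∞ = T_{C,g}^∞`. -/
theorem limit_Tl_eq_limit_Tg {n : ℕ} {S : Fin n → Type}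
    (hn : 1 < n) [∀ i, Fintype (S i)] [∀ i, Nonempty (S i)]
    (G : Game n S) (C : Set (Fin n)) :
    limit (Tl G C) = limit (Tg G C) := by
  funext i
  simp only [limit, iter_aux G C]
end

section
/- With the optimality notion φ = sd^g (global strict dominance), for every hypergraph H on the set of players, T_N^∞ ⊆ G(H), i.e. the customary outcome of iterated elimination of strictly dominated strategies is included (componentwise) in the outcome of iterated elimination with respect to H. -/
open scoped Classical

variable {n : ℕ} {S : Fin n → Type}

theorem sdg_mono_aux {n : ℕ} {S : Fin n → Type} (G : Game n S) {R R' : Restriction S}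
    (h : RestrLE R R') {i : Fin n} {si : S i} (hs : sdg G R i si) : sdg G R' i si := by
  rintro ⟨t, ht⟩
  exact hs ⟨t, fun o ho => ht o (fun j hj => h j (ho j hj))⟩

theorem iter_le_aux {n : ℕ} {S : Fin n → Type} (G : Game n S) (A : Set (Fin n)) (k : ℕ) :
    RestrLE (iter (Tg G Set.univ) k) (iter (Tg G A) k) := by
  induction k with
  | zero => exact fun i => subset_rfl
  | succ k ih =>
    intro i s hs
    simp only [iter, Tg, Set.mem_univ, if_true] at hs
    simp only [iter, Tg]
    split_ifs with hA
    · exact ⟨ih i hs.1, sdg_mono_aux G ih hs.2⟩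
    · exact ih i hs.1

theorem iter_anti_aux {n : ℕ} {S : Fin n → Type} (G : Game n S) :
    Antitone (fun k => iter (Tg G (Set.univ : Set (Fin n))) k) := by
  refine antitone_nat_of_succ_le (fun k i s hs => ?_)
  simp only [iter, Tg, Set.mem_univ, if_true] at hs
  exact hs.1

/-- With `φ = sd^g`, for every hypergraph `H`, `T_N^∞ ⊆ G(H)`. -/
theorem limit_TN_subset_outcomeG {n : ℕ} {S : Fin n → Type}
    (hn : 1 < n) [∀ i, Fintype (S i)] [∀ i, Nonempty (S i)]
    (G : Game n S) (H : Set (Set (Fin n))) (hH : ∀ A ∈ H, A.Nonempty) :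
    RestrLE (limit (Tg G (Set.univ : Set (Fin n)))) (outcomeG G H) := by
  obtain ⟨K, hK⟩ := WellFoundedGT.monotone_chain_condition
    (α := (Restriction S)ᵒᵈ)
    ⟨fun k => OrderDual.toDual (iter (Tg G (Set.univ : Set (Fin n))) k),
      fun a b hab => iter_anti_aux G hab⟩
  have hK' : ∀ m, K ≤ m → iter (Tg G (Set.univ : Set (Fin n))) K = iter (Tg G Set.univ) m :=
    fun m hm => hK m hm
  have hlim : RestrLE (iter (Tg G (Set.univ : Set (Fin n))) K) (limit (Tg G Set.univ)) := by
    intro i s hs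
    refine Set.mem_iInter.2 (fun k => ?_)
    rcases le_total K k with h | h
    · rw [← hK' k h]; exact hs
    · exact iter_anti_aux G h i hs
  have hA : ∀ A : Set (Fin n), RestrLE (limit (Tg G Set.univ)) (limit (Tg G A)) := by
    intro A i s hs
    exact Set.mem_iInter.2 (fun k => iter_le_aux G A k i (Set.mem_iInter.1 hs k))
  intro i s hs
  have h1 := Set.mem_iInter.1 hs (K + 1)
  simp only [iter, Tg, Set.mem_univ, if_true] at h1
  simp only [outcomeG, Tg, Set.mem_singleton_iff, if_true]
  refine ⟨Set.mem_iInter₂.2 (fun A _ => hA A i hs), sdg_mono_aux G ?_ h1.2⟩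
  intro j t ht
  exact Set.mem_iInter₂.2 (fun A _ => hA A j (hlim j ht))
end

section
/- With the optimality notion φ = sd^ℓ (local strict dominance), for every hypergraph H on the set of players, T_N^∞ ⊆ G(H), i.e. the customary outcome of iterated elimination of strictly dominated strategies is included (componentwise) in the outcome of iterated elimination with respect to H. -/
open scoped Classical

variable {n : ℕ} {S : Fin n → Type}

theorem aux_Tl_le (G : Game n S) (A : Set (Fin n)) (R : Restriction S) (i : Fin n) :
    Tl G A R i ⊆ R i := by
  intro x hx
  unfold Tl at hx
  split_ifs at hx
  · exact hx.1
  · exact hx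

theorem aux_anti (G : Game n S) (A : Set (Fin n)) : Antitone (iter (Tl G A)) :=
  antitone_nat_of_succ_le (fun k i => aux_Tl_le G A (iter (Tl G A) k) i)

theorem aux_max [∀ i, Fintype (S i)] (G : Game n S) (R : Restriction S)
    (hR : ∀ j, (R j).Nonempty) (i : Fin n) (t : S i) (ht : t ∈ R i) :
    ∃ t' ∈ R i, sdl G R i t' ∧
      (t' = t ∨ ∀ sOpp : Opp S i, inOpp R sOpp → G.pref i sOpp t' t) := by
  let r : S i → S i → Prop := fun a b => ∀ sOpp : Opp S i, inOpp R sOpp → G.pref i sOpp a b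
  have h1 : IsTrans (S i) r := ⟨fun a b c hab hbc s hs => G.trans i s a b c (hab s hs) (hbc s hs)⟩
  have h2 : Std.Irrefl r := ⟨fun a h =>
    G.irrefl i (fun j _ => (hR j).some) a (h _ (fun j _ => (hR j).some_mem))⟩
  have wf : WellFounded r := Finite.wellFounded_of_trans_of_irrefl r
  induction t using wf.induction with
  | _ t ih =>
    by_cases h : sdl G R i t
    · exact ⟨t, ht, h, Or.inl rfl⟩
    · unfold sdl at h
      push Not at h
      obtain ⟨u, hu, hd⟩ := h
      obtain ⟨v, hv, hv1, hv2⟩ := ih u hd hu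
      refine ⟨v, hv, hv1, Or.inr ?_⟩
      rcases hv2 with rfl | hv2
      · exact hd
      · exact fun s hs => G.trans i s _ _ _ (hv2 s hs) (hd s hs)

theorem aux_nonempty [∀ i, Fintype (S i)] [∀ i, Nonempty (S i)] (G : Game n S) (k : ℕ) :
    ∀ j, (iter (Tl G Set.univ) k j).Nonempty := by
  induction k with
  | zero => exact fun j => Set.univ_nonempty
  | succ k ih =>
    intro j
    obtain ⟨t, ht⟩ := ih j
    obtain ⟨u, hu, hu1, -⟩ := aux_max G _ ih j t ht
    exact ⟨u, by simp only [iter, Tl, Set.mem_univ, if_true]; exact ⟨hu, hu1⟩⟩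

theorem aux_stab [∀ i, Fintype (S i)] (G : Game n S) (A : Set (Fin n)) :
    ∃ K, limit (Tl G A) = iter (Tl G A) K ∧ iter (Tl G A) (K + 1) = iter (Tl G A) K := by
  obtain ⟨K, hK⟩ := WellFoundedGT.monotone_chain_condition
    (α := (Restriction S)ᵒᵈ) ⟨fun k => OrderDual.toDual (iter (Tl G A) k), fun a b h => aux_anti G A h⟩
  have hK' : ∀ m, K ≤ m → iter (Tl G A) K = iter (Tl G A) m := fun m hm => hK m hm
  refine ⟨K, ?_, (hK' _ (Nat.le_succ K)).symm⟩
  funext i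
  apply Set.Subset.antisymm
  · exact Set.iInter_subset _ K
  · refine Set.subset_iInter (fun m => ?_)
    rcases le_total K m with h | h
    · rw [hK' m h]
    · exact aux_anti G A h i

theorem aux_key [∀ i, Fintype (S i)] [∀ i, Nonempty (S i)] (G : Game n S)
    (i : Fin n) (s : S i) (hs : s ∈ limit (Tl G Set.univ) i) :
    sdg G (limit (Tl G Set.univ)) i s := by
  rintro ⟨t, ht⟩
  have step : ∀ k, ∃ u ∈ iter (Tl G Set.univ) k i, ∀ sOpp : Opp S i,
      inOpp (limit (Tl G Set.univ)) sOpp → G.pref i sOpp u s := by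
    intro k
    induction k with
    | zero => exact ⟨t, Set.mem_univ _, ht⟩
    | succ k ih =>
      obtain ⟨u, hu, hd⟩ := ih
      obtain ⟨v, hv, hv1, hv2⟩ := aux_max G _ (aux_nonempty G k) i u hu
      refine ⟨v, by simp only [iter, Tl, Set.mem_univ, if_true]; exact ⟨hv, hv1⟩, ?_⟩
      rcases hv2 with rfl | hv2
      · exact hd
      · exact fun o ho => G.trans i o _ _ _
          (hv2 o (fun j hj => Set.mem_iInter.1 (ho j hj) k)) (hd o ho)
  obtain ⟨K, hK, hK1⟩ := aux_stab G (Set.univ : Set (Fin n))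
  obtain ⟨u, hu, hd⟩ := step K
  rw [hK] at hs hd
  rw [← hK1] at hs
  simp only [iter, Tl, Set.mem_univ, if_true] at hs
  exact hs.2 ⟨u, hu, hd⟩

theorem aux_Tl_mem [∀ i, Fintype (S i)] [∀ i, Nonempty (S i)] (G : Game n S) (A : Set (Fin n))
    (R : Restriction S) (hR : RestrLE (limit (Tl G Set.univ)) R) :
    RestrLE (limit (Tl G Set.univ)) (Tl G A R) := by
  intro i s hs
  unfold Tl
  split_ifs
  · refine ⟨hR i hs, ?_⟩
    rintro ⟨t, -, ht⟩
    exact aux_key G i s hs ⟨t, fun o ho => ht o (fun j hj => hR j (ho j hj))⟩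
  · exact hR i hs

/-- With `φ = sd^ℓ`, for every hypergraph `H`, `T_N^∞ ⊆ G(H)`. -/
theorem limit_TN_subset_outcomeL {n : ℕ} {S : Fin n → Type}
    (hn : 1 < n) [∀ i, Fintype (S i)] [∀ i, Nonempty (S i)]
    (G : Game n S) (H : Set (Set (Fin n))) (hH : ∀ A ∈ H, A.Nonempty) :
    RestrLE (limit (Tl G (Set.univ : Set (Fin n)))) (outcomeL G H) := by
  intro i
  refine aux_Tl_mem G {i} _ ?_ i
  intro j
  refine Set.subset_iInter₂ (fun A _ => Set.subset_iInter (fun k => ?_))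
  have h : ∀ k, RestrLE (limit (Tl G Set.univ)) (iter (Tl G A) k) := by
    intro k
    induction k with
    | zero => exact fun j => Set.subset_univ _
    | succ k ih => exact aux_Tl_mem G A _ ih
  exact h k j
end

section
/- For any hypergraph H and any set M of truthful messages, the outcome G(H, M) does not depend on the choice of optimality notion: computing G(H, M) with the global notion sd^g yields the same restriction as computing it with the local notion sd^ℓ. -/
open scoped Classical

variable {n : ℕ} {S : Fin n → Type}

/-- An atomic preference statement of player `pl`: given the joint strategy `opp` of the
opponents, `pl` strictly prefers `better` to `worse`. -/
structure Atom (n : ℕ) (S : Fin n → Type) where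
  pl : Fin n
  opp : Opp S pl
  better : S pl
  worse : S pl

/-- The atom holds in the game `G`. -/
def Atom.Holds {n : ℕ} {S : Fin n → Type} (G : Game n S) (a : Atom n S) : Prop :=
  G.pref a.pl a.opp a.better a.worse

/-- A message: a player (`sender`) communicates one of his atomic preference statements
to a group (`grp`). -/
structure Msg (n : ℕ) (S : Fin n → Type) where
  sender : Fin n
  grp : Set (Fin n)
  atom : Atom n S

/-- Well-formedness of a message w.r.t. the hypergraph `H`: the atom concerns the sender's
own preferences, the sender belongs to the group, and the group is a hyperarc of `H`. -/
def Msg.Wf {n : ℕ} {S : Fin n → Type} (H : Set (Set (Fin n))) (m : Msg n S) : Prop :=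
  m.atom.pl = m.sender ∧ m.sender ∈ m.grp ∧ m.grp ∈ H

variable {n : ℕ} {S : Fin n → Type}

/-- Entailment `M↾_A ⊨ s'_i ≻_{s_{-i}} s_i`: there is a chain of messages in `M`, each sent to
a group containing `A`, connecting `si'` to `si` (for the fixed `sOpp`). -/
def entails (M : Set (Msg n S)) (A : Set (Fin n)) {i : Fin n} (sOpp : Opp S i)
    (si' si : S i) : Prop :=
  Relation.TransGen
    (fun a b : S i => ∃ m ∈ M, A ⊆ m.grp ∧ m.atom = ⟨i, sOpp, a, b⟩) si' si

/-- The intermediate optimality notion `sd^g_{A,M}(s_i, G')`. -/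
def sdgAM (G : Game n S) (M : Set (Msg n S)) (A : Set (Fin n)) (R : Restriction S)
    (i : Fin n) (si : S i) : Prop :=
  if A = {i} then
    ¬ ∃ si' : S i, ∀ sOpp : Opp S i, inOpp R sOpp → G.pref i sOpp si' si
  else
    ¬ ∃ si' : S i, ∀ sOpp : Opp S i, inOpp R sOpp → entails M A sOpp si' si

/-- The intermediate optimality notion `sd^ℓ_{A,M}(s_i, G')` (dominating strategy must lie
in the restriction). -/
def sdlAM (G : Game n S) (M : Set (Msg n S)) (A : Set (Fin n)) (R : Restriction S)
    (i : Fin n) (si : S i) : Prop :=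
  if A = {i} then
    ¬ ∃ si' ∈ R i, ∀ sOpp : Opp S i, inOpp R sOpp → G.pref i sOpp si' si
  else
    ¬ ∃ si' ∈ R i, ∀ sOpp : Opp S i, inOpp R sOpp → entails M A sOpp si' si

/-- The operator `T_{A,M}` (global version). -/
def TgAM (G : Game n S) (M : Set (Msg n S)) (A : Set (Fin n)) (R : Restriction S) :
    Restriction S :=
  fun i => {si ∈ R i | sdgAM G M A R i si}

/-- The operator `T_{A,M}` (local version). -/
def TlAM (G : Game n S) (M : Set (Msg n S)) (A : Set (Fin n)) (R : Restriction S) :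
    Restriction S :=
  fun i => {si ∈ R i | sdlAM G M A R i si}

/-- The closure `H̄` of the hypergraph `H` under nonempty intersection. -/
def Hbar (H : Set (Set (Fin n))) : Set (Set (Fin n)) :=
  {B | B.Nonempty ∧ ∃ 𝒜 : Set (Set (Fin n)), 𝒜 ⊆ H ∧ 𝒜.Nonempty ∧ B = ⋂₀ 𝒜}

/-- The outcome `G(H,M)` of iterated elimination with respect to `H` and an intermediate
state `M` (global version): `G(H,M)_i = (T_{{i},M}(⋂_{A : i ∈ A ∈ H̄} T_{A,M}^∞))_i`. -/
def outcomeGM (G : Game n S) (H : Set (Set (Fin n))) (M : Set (Msg n S)) : Restriction S :=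
  fun i => TgAM G M {i}
    (fun j => ⋂ A ∈ {A : Set (Fin n) | i ∈ A ∧ A ∈ Hbar H}, limit (TgAM G M A) j) i

/-- The outcome `G(H,M)` (local version). -/
def outcomeLM (G : Game n S) (H : Set (Set (Fin n))) (M : Set (Msg n S)) : Restriction S :=
  fun i => TlAM G M {i}
    (fun j => ⋂ A ∈ {A : Set (Fin n) | i ∈ A ∧ A ∈ Hbar H}, limit (TlAM G M A) j) i

/-- The set `M^H` of all truthful messages permitted by `H`. -/
def allMsgs (G : Game n S) (H : Set (Set (Fin n))) : Set (Msg n S) :=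
  {m | m.Wf H ∧ m.atom.Holds G}

theorem exMax {α : Type} [Finite α] (D : α → α → Prop) (ht : ∀ a b c, D a b → D b c → D a c)
    (hi : ∀ a, ¬ D a a) (s : α) : ∃ m, (m = s ∨ D m s) ∧ ∀ x, ¬ D x m := by
  haveI : IsTrans α D := ⟨ht⟩
  haveI : Std.Irrefl D := ⟨hi⟩
  obtain ⟨m, hm, hmin⟩ := (Finite.wellFounded_of_trans_of_irrefl D).has_min
    {t | t = s ∨ D t s} ⟨s, Or.inl rfl⟩
  refine ⟨m, hm, fun x hx => hmin x ?_ hx⟩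
  rcases hm with rfl | hm
  · exact Or.inr hx
  · exact Or.inr (ht _ _ _ hx hm)

def relAM (G : Game n S) (M : Set (Msg n S)) (A : Set (Fin n)) (i : Fin n) (o : Opp S i)
    (a b : S i) : Prop := if A = {i} then G.pref i o a b else entails M A o a b

def domAM (G : Game n S) (M : Set (Msg n S)) (A : Set (Fin n)) (R : Restriction S)
    (i : Fin n) (a b : S i) : Prop := ∀ o : Opp S i, inOpp R o → relAM G M A i o a b

theorem sdgAM_iff (G : Game n S) (M : Set (Msg n S)) (A : Set (Fin n)) (R : Restriction S)
    (i : Fin n) (s : S i) : sdgAM G M A R i s ↔ ∀ t, ¬ domAM G M A R i t s := by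
  unfold sdgAM domAM relAM
  split_ifs with h <;> simp

theorem sdlAM_iff (G : Game n S) (M : Set (Msg n S)) (A : Set (Fin n)) (R : Restriction S)
    (i : Fin n) (s : S i) : sdlAM G M A R i s ↔ ∀ t ∈ R i, ¬ domAM G M A R i t s := by
  unfold sdlAM domAM relAM
  split_ifs with h <;> simp

theorem entails_pref (G : Game n S) (M : Set (Msg n S)) (htruth : ∀ m ∈ M, m.atom.Holds G)
    (A : Set (Fin n)) (i : Fin n) (o : Opp S i) (a b : S i) (h : entails M A o a b) :
    G.pref i o a b := by
  have key : ∀ a b : S i, (∃ m ∈ M, A ⊆ m.grp ∧ m.atom = ⟨i, o, a, b⟩) → G.pref i o a b := by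
    rintro a b ⟨m, hm, -, he⟩
    have := htruth m hm
    rw [he] at this
    exact this
  unfold entails at h
  induction h with
  | single h => exact key _ _ h
  | tail _ h ih => exact G.trans _ _ _ _ _ ih (key _ _ h)

theorem relAM_pref (G : Game n S) (M : Set (Msg n S)) (htruth : ∀ m ∈ M, m.atom.Holds G)
    (A : Set (Fin n)) (i : Fin n) (o : Opp S i) (a b : S i) (h : relAM G M A i o a b) :
    G.pref i o a b := by
  unfold relAM at h
  split_ifs at h
  · exact h
  · exact entails_pref G M htruth A i o a b h

theorem relAM_trans (G : Game n S) (M : Set (Msg n S))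
    (A : Set (Fin n)) (i : Fin n) (o : Opp S i) (a b c : S i) (h : relAM G M A i o a b)
    (h' : relAM G M A i o b c) : relAM G M A i o a c := by
  unfold relAM at *
  split_ifs at *
  · exact G.trans _ _ _ _ _ h h'
  · exact Relation.TransGen.trans h h'

theorem relAM_mono (G : Game n S) (M : Set (Msg n S)) (htruth : ∀ m ∈ M, m.atom.Holds G)
    (A : Set (Fin n)) (i j : Fin n) (hi : i ∈ A) (o : Opp S j) (a b : S j)
    (h : relAM G M A j o a b) : relAM G M {i} j o a b := by
  by_cases hij : i = j
  · subst hij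
    have := relAM_pref G M htruth A i o a b h
    simpa [relAM] using this
  · have h1 : A ≠ {j} := by
      rintro rfl
      exact hij hi
    have h2 : ({i} : Set (Fin n)) ≠ {j} := by
      intro h
      exact hij (Set.singleton_injective h)
    unfold relAM at *
    rw [if_neg h1] at h
    rw [if_neg h2]
    refine Relation.TransGen.mono ?_ _ _ h
    rintro x y ⟨m, hm, hA, he⟩
    exact ⟨m, hm, (Set.singleton_subset_iff.2 hi).trans hA, he⟩

theorem domAM_anti (G : Game n S) (M : Set (Msg n S)) (A : Set (Fin n)) (R R' : Restriction S)
    (hR : ∀ j, R' j ⊆ R j) (i : Fin n) (a b : S i) (h : domAM G M A R i a b) :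
    domAM G M A R' i a b := fun o ho => h o fun j hj => hR j (ho j hj)

theorem domMax [∀ i, Fintype (S i)] (G : Game n S) (M : Set (Msg n S))
    (htruth : ∀ m ∈ M, m.atom.Holds G) (A : Set (Fin n)) (R : Restriction S)
    (hne : ∀ j, (R j).Nonempty) (i : Fin n) (s : S i) :
    ∃ m, (m = s ∨ domAM G M A R i m s) ∧ ∀ x, ¬ domAM G M A R i x m := by
  refine exMax _ (fun a b c h h' o ho => relAM_trans G M A i o a b c (h o ho) (h' o ho)) ?_ s
  intro a h
  choose f hf using hne
  exact G.irrefl i (fun j _ => f j) a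
    (relAM_pref G M htruth A i _ a a (h (fun j _ => f j) (fun j _ => hf j)))

theorem iter_anti (G : Game n S) (M : Set (Msg n S)) (A : Set (Fin n)) (j : Fin n) :
    Antitone (fun k => iter (TgAM G M A) k j) :=
  antitone_nat_of_succ_le fun _ _ h => h.1

/-- a strategy that is undominated on a smaller restriction survives -/
theorem mem_iter (G : Game n S) (M : Set (Msg n S)) (A : Set (Fin n)) (i : Fin n) (s : S i)
    (K : ℕ) (h : ∀ k < K, ∀ t, ¬ domAM G M A (iter (TgAM G M A) k) i t s) :
    s ∈ iter (TgAM G M A) K i := by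
  induction K with
  | zero => exact Set.mem_univ _
  | succ K ih =>
    exact ⟨ih fun k hk => h k (by omega), (sdgAM_iff ..).2 (h K (by omega))⟩

theorem mem_iter' (G : Game n S) (M : Set (Msg n S)) (A : Set (Fin n)) (i : Fin n) (s : S i)
    (K : ℕ) (h : ∀ t, ¬ domAM G M A (iter (TgAM G M A) K) i t s) :
    s ∈ iter (TgAM G M A) K i :=
  mem_iter G M A i s K fun k hk t ht =>
    h t (domAM_anti G M A _ _ (fun j => iter_anti G M A j hk.le) i t s ht)

theorem iter_ne [∀ i, Fintype (S i)] [∀ i, Nonempty (S i)] (G : Game n S) (M : Set (Msg n S))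
    (htruth : ∀ m ∈ M, m.atom.Holds G) (A : Set (Fin n)) (k : ℕ) :
    ∀ j, (iter (TgAM G M A) k j).Nonempty := by
  induction k with
  | zero => exact fun j => Set.univ_nonempty
  | succ k ih =>
    intro j
    obtain ⟨m, -, hm⟩ := domMax G M htruth A _ ih j (Classical.arbitrary (S j))
    exact ⟨m, mem_iter' G M A j m k hm, (sdgAM_iff ..).2 hm⟩

theorem iter_eq [∀ i, Fintype (S i)] [∀ i, Nonempty (S i)] (G : Game n S) (M : Set (Msg n S))
    (htruth : ∀ m ∈ M, m.atom.Holds G) (A : Set (Fin n)) (k : ℕ) :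
    iter (TlAM G M A) k = iter (TgAM G M A) k := by
  induction k with
  | zero => rfl
  | succ k ih =>
    change TlAM G M A (iter (TlAM G M A) k) = TgAM G M A (iter (TgAM G M A) k)
    rw [ih]
    funext i
    ext s
    refine and_congr_right fun _ => ?_
    rw [sdgAM_iff, sdlAM_iff]
    refine ⟨fun h t ht => ?_, fun h t _ => h t⟩
    obtain ⟨m, hms, hm⟩ := domMax G M htruth A _ (iter_ne G M htruth A k) i s
    rcases hms with rfl | hms
    · exact hm t ht
    · exact h m (mem_iter' G M A i m k hm) hms

theorem limit_ne [∀ i, Fintype (S i)] [∀ i, Nonempty (S i)] (G : Game n S) (M : Set (Msg n S))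
    (htruth : ∀ m ∈ M, m.atom.Holds G) (A : Set (Fin n)) (j : Fin n) :
    (limit (TgAM G M A) j).Nonempty := by
  by_contra hcon
  have h : ∀ x : S j, ∃ k, x ∉ iter (TgAM G M A) k j := by
    intro x
    by_contra hx
    push Not at hx
    exact hcon ⟨x, Set.mem_iInter.2 hx⟩
  choose f hf using h
  obtain ⟨x, hx⟩ := iter_ne G M htruth A (Finset.univ.sup f) j
  exact hf x (iter_anti G M A j (Finset.le_sup (Finset.mem_univ x)) hx)

theorem iter_sub (G : Game n S) (M : Set (Msg n S)) (htruth : ∀ m ∈ M, m.atom.Holds G)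
    (A : Set (Fin n)) (i : Fin n) (hi : i ∈ A) (k : ℕ) :
    ∀ j, iter (TgAM G M {i}) k j ⊆ iter (TgAM G M A) k j := by
  induction k with
  | zero => exact fun j => subset_rfl
  | succ k ih =>
    rintro j s ⟨hs, hd⟩
    refine ⟨ih j hs, (sdgAM_iff ..).2 fun t ht => (sdgAM_iff ..).1 hd t fun o ho => ?_⟩
    exact relAM_mono G M htruth A i j hi o t s (ht o fun l hl => ih l (ho l hl))

/-- For any hypergraph `H` and any set `M` of truthful messages, the outcome
`G(H,M)` computed with `sd^g` equals the one computed with `sd^ℓ`. -/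
theorem outcomeGM_eq_outcomeLM {n : ℕ} {S : Fin n → Type}
    (hn : 1 < n) [∀ i, Fintype (S i)] [∀ i, Nonempty (S i)]
    (G : Game n S) (H : Set (Set (Fin n))) (hH : ∀ A ∈ H, A.Nonempty)
    (M : Set (Msg n S)) (hwf : ∀ m ∈ M, m.Wf H) (htruth : ∀ m ∈ M, m.atom.Holds G) :
    outcomeGM G H M = outcomeLM G H M := by
  have hl : ∀ A, limit (TlAM G M A) = limit (TgAM G M A) := by
    intro A
    unfold limit
    simp only [iter_eq G M htruth A]
  funext i
  unfold outcomeGM outcomeLM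
  simp only [hl]
  set R : Restriction S :=
    fun j => ⋂ A ∈ {A : Set (Fin n) | i ∈ A ∧ A ∈ Hbar H}, limit (TgAM G M A) j with hR
  have hne : ∀ j, (R j).Nonempty := by
    intro j
    obtain ⟨x, hx⟩ := limit_ne G M htruth {i} j
    refine ⟨x, Set.mem_iInter₂.2 fun A hA => Set.mem_iInter.2 fun k => ?_⟩
    exact iter_sub G M htruth A i hA.1 k j (Set.mem_iInter.1 hx k)
  ext s
  refine and_congr_right fun _ => ?_
  rw [sdgAM_iff, sdlAM_iff]
  refine ⟨fun h t _ => h t, fun h t ht => ?_⟩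
  obtain ⟨m, hms, hm⟩ := domMax G M htruth {i} R hne i s
  rcases hms with rfl | hms
  · exact hm t ht
  · refine h m ?_ hms
    refine Set.mem_iInter₂.2 fun A hA => Set.mem_iInter.2 fun k => ?_
    refine mem_iter' G M A i m k fun u hu => hm u fun o ho => ?_
    refine relAM_mono G M htruth A i i hA.1 o u m (hu o fun j hj => ?_)
    exact Set.mem_iInter.1 (Set.mem_iInter₂.1 (ho j hj) A hA) k
end

section
/- Let T and U be operators on a finite lattice (D, ⊆) with largest element ⊤, such that T is monotonic and contracting. For Y ∈ D define the operator T_Y by T_Y(X) := T(X) ∪ (X ∩ Y). Then T_{T^∞ ∩ U^∞}^∞(U^∞) = T^∞ ∩ U^∞. -/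
/-- Let `T` and `U` be operators on a finite lattice with largest element `⊤`,
with `T` monotonic and contracting. For `Y` define `T_Y(X) := T(X) ⊔ (X ⊓ Y)`. Then
`T_{T^∞ ⊓ U^∞}^∞(U^∞) = T^∞ ⊓ U^∞`, where `V^∞(X) := ⨅ k, V^k(X)` and `V^∞ := V^∞(⊤)`. -/
theorem limit_modified_iteration {D : Type*} [CompleteLattice D] [Finite D]
    (T U : D → D) (hmono : Monotone T) (hcontr : ∀ X, T X ≤ X) :
    (⨅ k : ℕ,
        (fun X => T X ⊔ (X ⊓ ((⨅ k : ℕ, T^[k] ⊤) ⊓ (⨅ k : ℕ, U^[k] ⊤))))^[k]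
          (⨅ k : ℕ, U^[k] ⊤)) =
      (⨅ k : ℕ, T^[k] ⊤) ⊓ (⨅ k : ℕ, U^[k] ⊤) := by
  generalize ht : (⨅ k : ℕ, T^[k] ⊤) = t
  generalize (⨅ k : ℕ, U^[k] ⊤) = u
  apply le_antisymm
  · apply le_inf
    · rw [← ht]
      refine iInf_mono fun k => ?_
      rw [ht]
      induction k with
      | zero => exact le_top
      | succ n ih =>
        rw [Function.iterate_succ_apply', Function.iterate_succ_apply']
        refine sup_le (hmono ih) (inf_le_right.trans (inf_le_left.trans ?_))
        rw [← Function.iterate_succ_apply' T, ← ht]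
        exact iInf_le _ (n + 1)
    · exact iInf_le_of_le 0 le_rfl
  · refine le_iInf fun k => ?_
    induction k with
    | zero => exact inf_le_right
    | succ n ih =>
      rw [Function.iterate_succ_apply']
      exact le_sup_of_le_right (le_inf ih le_rfl)
end

section
/- For any ℓ ≥ 1, player i, strategy s_i ∈ S_i, and state (V,M): (V,M) ⊨ dom^{ℓ+1}(s_i) if and only if (V,M) ⊨ ⋁_{s'_i∈S_i} ⋀_{s_{-i}∈S_{-i}} [ K_i(s'_i ≻_{s_{-i}} s_i) ∨ ⋁_{A: i∈A∈H̄} ⋁_{j∈A∖{i}} C_A dom^ℓ(s_j) ], where H̄ is the closure of the hypergraph H under nonempty intersection. -/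
open scoped Classical

variable {n : ℕ} {S : Fin n → Type}

variable {n : ℕ} {S : Fin n → Type}

set_option linter.unusedSectionVars false

/-- The positive epistemic language `L⁺`: atoms, conjunction, disjunction and common
knowledge operators `C_A` (`K_i := C_{{i}}`). -/
inductive Form (n : ℕ) (S : Fin n → Type) where
  | atom : Atom n S → Form n S
  | and : Form n S → Form n S → Form n S
  | or : Form n S → Form n S → Form n S
  | ck : Set (Fin n) → Form n S → Form n S

variable {n : ℕ} {S : Fin n → Type}

/-- A valuation: a set of atoms whose slices (for fixed player and opponents' joint strategy)
are irreflexive and transitive. -/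
def IsValuation (V : Set (Atom n S)) : Prop :=
  ∀ (i : Fin n) (sOpp : Opp S i),
    (∀ s : S i, (⟨i, sOpp, s, s⟩ : Atom n S) ∉ V) ∧
    (∀ a b c : S i, (⟨i, sOpp, a, b⟩ : Atom n S) ∈ V →
      (⟨i, sOpp, b, c⟩ : Atom n S) ∈ V → (⟨i, sOpp, a, c⟩ : Atom n S) ∈ V)

/-- A state `(V, M)`: a valuation `V` together with a set `M` of well-formed messages
truthful w.r.t. `V`. -/
structure EpState (n : ℕ) (S : Fin n → Type) (H : Set (Set (Fin n))) where
  V : Set (Atom n S)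
  M : Set (Msg n S)
  val : IsValuation V
  wf : ∀ m ∈ M, m.Wf H
  truthful : ∀ m ∈ M, m.atom ∈ V

variable {H : Set (Set (Fin n))}

/-- Indistinguishability `~_i` of states for player `i`: same atoms about `i`'s preferences
and same messages addressed to groups containing `i`. -/
def simI (i : Fin n) (s t : EpState n S H) : Prop :=
  {a ∈ s.V | a.pl = i} = {a ∈ t.V | a.pl = i} ∧
  {m ∈ s.M | i ∈ m.grp} = {m ∈ t.M | i ∈ m.grp}

/-- `~_A`: the transitive closure of `⋃_{i ∈ A} ~_i`. -/
def simA (A : Set (Fin n)) : EpState n S H → EpState n S H → Prop :=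
  Relation.TransGen (fun s t => ∃ i ∈ A, simI i s t)

/-- Semantics of `L⁺`. -/
def sat (s : EpState n S H) : Form n S → Prop
  | .atom a => a ∈ s.V
  | .and f g => sat s f ∧ sat s g
  | .or f g => sat s f ∨ sat s g
  | .ck A f => ∀ t : EpState n S H, simA A s t → sat t f

variable [∀ i, Fintype (S i)] [∀ i, Nonempty (S i)]

/-- An atom that is false in every valuation (by irreflexivity); used as the value of an
empty disjunction. -/
noncomputable def falseAtom (i : Fin n) (si : S i) : Form n S :=
  .atom ⟨i, fun j _ => Classical.arbitrary (S j), si, si⟩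

/-- Disjunction of a list of formulas (`dflt` for the empty list). -/
def bigOr (dflt : Form n S) : List (Form n S) → Form n S
  | [] => dflt
  | f :: l => l.foldl Form.or f

/-- Conjunction of a list of formulas (`dflt` for the empty list). -/
def bigAnd (dflt : Form n S) : List (Form n S) → Form n S
  | [] => dflt
  | f :: l => l.foldl Form.and f

/-- A list of all strategies of player `i`. -/
noncomputable def stratList (i : Fin n) : List (S i) := Finset.univ.toList

/-- A list of all joint strategies of the opponents of `i`. -/
noncomputable def oppList (i : Fin n) : List (Opp S i) :=
  haveI : Fintype (Opp S i) := Fintype.ofFinite _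
  Finset.univ.toList

/-- A list of all players different from `i`. -/
noncomputable def othersList (i : Fin n) : List {j : Fin n // j ≠ i} :=
  haveI : Fintype {j : Fin n // j ≠ i} := Fintype.ofFinite _
  Finset.univ.toList

/-- `domF ℓ i si` is the formula `dom^{ℓ+1}(s_i)` of the paper:
`domF 0 = dom^1` and `domF (ℓ+1) = dom^{ℓ+2}`. -/
noncomputable def domF : ℕ → ∀ i : Fin n, S i → Form n S
  | 0, i, si =>
      .ck {i} (bigOr (falseAtom i si) ((stratList i).map fun si' =>
        bigAnd (falseAtom i si) ((oppList i).map fun sOpp =>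
          .atom ⟨i, sOpp, si', si⟩)))
  | ℓ + 1, i, si =>
      .ck {i} (bigOr (falseAtom i si) ((stratList i).map fun si' =>
        bigAnd (falseAtom i si) ((oppList i).map fun sOpp =>
          bigOr (falseAtom i si)
            (Form.atom ⟨i, sOpp, si', si⟩ ::
              (othersList i).map fun j => domF ℓ j.1 (sOpp j.1 j.2)))))

/-- The valuation induced by a game is indeed a valuation. -/
theorem isValuation_induced (G : Game n S) : IsValuation {a : Atom n S | a.Holds G} := by
  intro i sOpp
  constructor
  · intro s hs
    exact G.irrefl i sOpp s hs
  · intro a b c hab hbc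
    exact G.trans i sOpp a b c hab hbc

/-- The state `(V, M)` where `V` is the valuation induced by the game `G`. -/
noncomputable def stateOf (G : Game n S) (H : Set (Set (Fin n))) (M : Set (Msg n S))
    (hwf : ∀ m ∈ M, m.Wf H) (htruth : ∀ m ∈ M, m.atom.Holds G) : EpState n S H :=
  ⟨{a | a.Holds G}, M, isValuation_induced G, hwf, htruth⟩

/-- A list of all hyperarcs `A ∈ H̄` with `i ∈ A`. -/
noncomputable def hyperList {n : ℕ} (H : Set (Set (Fin n))) (i : Fin n) :
    List {A : Set (Fin n) // i ∈ A ∧ A ∈ Hbar H} :=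
  haveI : Fintype {A : Set (Fin n) // i ∈ A ∧ A ∈ Hbar H} := Fintype.ofFinite _
  Finset.univ.toList

/-- A list of all members of `A` other than `i`. -/
noncomputable def memOthersList {n : ℕ} (A : Set (Fin n)) (i : Fin n) :
    List {j : Fin n // j ∈ A ∧ j ≠ i} :=
  haveI : Fintype {j : Fin n // j ∈ A ∧ j ≠ i} := Fintype.ofFinite _
  Finset.univ.toList

/-- The formula `⋁_{s'_i} ⋀_{s_{-i}} [K_i(s'_i ≻_{s_{-i}} s_i) ∨ ⋁_{A : i∈A∈H̄} ⋁_{j∈A∖{i}}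
C_A dom^{k+1}(s_j)]`. -/
noncomputable def rhsF {n : ℕ} {S : Fin n → Type} [∀ i, Fintype (S i)] [∀ i, Nonempty (S i)]
    (H : Set (Set (Fin n))) (k : ℕ) (i : Fin n) (si : S i) : Form n S :=
  bigOr (falseAtom i si) ((stratList i).map fun si' =>
    bigAnd (falseAtom i si) ((oppList i).map fun sOpp =>
      .or (.ck {i} (.atom ⟨i, sOpp, si', si⟩))
        (bigOr (falseAtom i si) ((hyperList H i).map fun A =>
          bigOr (falseAtom i si) ((memOthersList A.1 i).map fun j =>
            .ck A.1 (domF k j.1 (sOpp j.1 j.2.2)))))))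

section Aux
variable {n : ℕ} {S : Fin n → Type} {H : Set (Set (Fin n))}

theorem aux_tgmono {α : Type*} {R Q : α → α → Prop} (h : ∀ x y, R x y → Q x y) {x y : α}
    (hxy : Relation.TransGen R x y) : Relation.TransGen Q x y := by
  induction hxy with
  | single h1 => exact .single (h _ _ h1)
  | tail _ h2 ih => exact ih.tail (h _ _ h2)

theorem aux_trans {V : Set (Atom n S)} (hV : IsValuation V) {i : Fin n} {o : Opp S i}
    {R : S i → S i → Prop} (h : ∀ x y, R x y → (⟨i, o, x, y⟩ : Atom n S) ∈ V)
    {x y : S i} (hxy : Relation.TransGen R x y) : (⟨i, o, x, y⟩ : Atom n S) ∈ V := by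
  induction hxy with
  | single h1 => exact h _ _ h1
  | tail _ h2 ih => exact (hV i o).2 _ _ _ ih (h _ _ h2)

/-- least state indistinguishable from `s` for `i` -/
def minSt (i : Fin n) (s : EpState n S H) : EpState n S H where
  V := {a | a ∈ s.V ∧ (a.pl = i ∨ Relation.TransGen (fun x y : S a.pl =>
    ∃ m ∈ s.M, i ∈ m.grp ∧ m.atom = ⟨a.pl, a.opp, x, y⟩) a.better a.worse)}
  M := {m | m ∈ s.M ∧ i ∈ m.grp}
  val := by
    intro p o
    refine ⟨fun x hx => (s.val p o).1 x hx.1, ?_⟩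
    rintro a b c ⟨h1, h2⟩ ⟨h3, h4⟩
    refine ⟨(s.val p o).2 _ _ _ h1 h3, ?_⟩
    rcases h2 with h2 | h2
    · exact Or.inl h2
    rcases h4 with h4 | h4
    · exact Or.inl h4
    exact Or.inr (Relation.TransGen.trans h2 h4)
  wf := fun m hm => s.wf m hm.1
  truthful := fun m hm => ⟨s.truthful m hm.1, Or.inr (.single ⟨m, hm.1, hm.2, rfl⟩)⟩

theorem simI_minSt (i : Fin n) (s : EpState n S H) : simI i s (minSt i s) := by
  constructor
  · ext a
    simp only [minSt, Set.mem_ofPred_eq]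
    tauto
  · ext a
    simp only [minSt, Set.mem_ofPred_eq]
    tauto

theorem simI_msg {i : Fin n} {s t : EpState n S H} (h : simI i s t) {m : Msg n S}
    (hm : m ∈ s.M) (hi : i ∈ m.grp) : m ∈ t.M := by
  have : m ∈ {m ∈ s.M | i ∈ m.grp} := ⟨hm, hi⟩
  rw [h.2] at this
  exact this.1

theorem simI_atom {i : Fin n} {s t : EpState n S H} (h : simI i s t) {a : Atom n S}
    (hm : a ∈ s.V) (hi : a.pl = i) : a ∈ t.V := by
  have : a ∈ {m ∈ s.V | m.pl = i} := ⟨hm, hi⟩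
  rw [h.1] at this
  exact this.1

theorem minSt_le {i : Fin n} {s s' t : EpState n S H} (hV : s.V ⊆ s'.V) (hM : s.M ⊆ s'.M)
    (h : simI i s' t) : (minSt i s).V ⊆ t.V ∧ (minSt i s).M ⊆ t.M := by
  constructor
  · rintro ⟨p, o, b, w⟩ ⟨h1, h2 | h2⟩
    · exact simI_atom h (hV h1) h2
    · refine aux_trans t.val ?_ h2
      rintro x y ⟨m, hm, hi, he⟩
      have := t.truthful m (simI_msg h (hM hm) hi)
      rw [he] at this
      exact this
  · rintro m ⟨h1, h2⟩
    exact simI_msg h (hM h1) h2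

theorem sat_mono (f : Form n S) : ∀ {s s' : EpState n S H}, s.V ⊆ s'.V → s.M ⊆ s'.M →
    sat s f → sat s' f := by
  induction f with
  | atom a => intro s s' hV _ h; exact hV h
  | and f g ihf ihg => intro s s' hV hM h; exact ⟨ihf hV hM h.1, ihg hV hM h.2⟩
  | or f g ihf ihg => intro s s' hV hM h; exact h.imp (ihf hV hM) (ihg hV hM)
  | ck A f ih =>
    intro s s' hV hM h t' ht'
    have key : ∃ t : EpState n S H, simA A s t ∧ t.V ⊆ t'.V ∧ t.M ⊆ t'.M := by
      induction ht' with
      | single h1 =>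
        obtain ⟨i, hi, h1⟩ := h1
        exact ⟨minSt i s, .single ⟨i, hi, simI_minSt i s⟩, minSt_le hV hM h1⟩
      | tail _ h1 ih2 =>
        obtain ⟨t, ht, h2, h3⟩ := ih2
        obtain ⟨i, hi, h1⟩ := h1
        exact ⟨minSt i t, ht.tail ⟨i, hi, simI_minSt i t⟩, minSt_le h2 h3 h1⟩
    obtain ⟨t, ht, h2, h3⟩ := key
    exact ih h2 h3 (h t ht)

theorem simA_msg {A : Set (Fin n)} {s t : EpState n S H} (h : simA A s t) {m : Msg n S}
    (hm : m ∈ s.M) (hA : A ⊆ m.grp) : m ∈ t.M := by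
  induction h with
  | single h1 => obtain ⟨i, hi, h1⟩ := h1; exact simI_msg h1 hm (hA hi)
  | tail _ h1 ih => obtain ⟨i, hi, h1⟩ := h1; exact simI_msg h1 ih (hA hi)

theorem simA_refl {A : Set (Fin n)} {i : Fin n} (hi : i ∈ A) (s : EpState n S H) :
    simA A s s := .single ⟨i, hi, rfl, rfl⟩

theorem simA_single_atom {i : Fin n} {s t : EpState n S H} (h : simA {i} s t) {a : Atom n S}
    (ha : a ∈ s.V) (hp : a.pl = i) : a ∈ t.V := by
  induction h with
  | single h1 => obtain ⟨j, rfl, h1⟩ := h1; exact simI_atom h1 ha hp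
  | tail _ h1 ih => obtain ⟨j, rfl, h1⟩ := h1; exact simI_atom h1 ih hp

theorem simA_mono {A B : Set (Fin n)} (hAB : A ⊆ B) {s t : EpState n S H} (h : simA A s t) :
    simA B s t :=
  aux_tgmono (fun _ _ ⟨i, hi, h⟩ => ⟨i, hAB hi, h⟩) h

/-- atoms in the double minimum come from messages to groups containing both -/
theorem minmin_atom {i j : Fin n} (hij : j ≠ i) (s : EpState n S H) {p : Fin n} {o : Opp S p}
    {b w : S p} (h : (⟨p, o, b, w⟩ : Atom n S) ∈ (minSt j (minSt i s)).V) :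
    Relation.TransGen (fun x y : S p =>
      ∃ m ∈ s.M, i ∈ m.grp ∧ j ∈ m.grp ∧ m.atom = ⟨p, o, x, y⟩) b w := by
  obtain ⟨⟨h0, h1⟩, h2 | h2⟩ := h
  · rcases h1 with h1 | h1
    · exact absurd (h2.symm.trans h1) hij
    · refine aux_tgmono ?_ h1
      rintro x y ⟨m, hm, hi, he⟩
      have hw := s.wf m hm
      refine ⟨m, hm, hi, ?_, he⟩
      have e1 : m.sender = j := by
        rw [← hw.1, he]; exact h2
      rw [← e1]; exact hw.2.1
  · refine aux_tgmono ?_ h2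
    rintro x y ⟨m, hm, hj, he⟩
    exact ⟨m, hm.1, hm.2, hj, he⟩

theorem sat_foldl_or (s : EpState n S H) (l : List (Form n S)) : ∀ f,
    sat s (l.foldl Form.or f) ↔ sat s f ∨ ∃ g ∈ l, sat s g := by
  induction l with
  | nil => simp
  | cons a l ih => intro f; simp [ih, sat, or_assoc]

theorem sat_foldl_and (s : EpState n S H) (l : List (Form n S)) : ∀ f,
    sat s (l.foldl Form.and f) ↔ sat s f ∧ ∀ g ∈ l, sat s g := by
  induction l with
  | nil => simp
  | cons a l ih => intro f; simp [ih, sat, and_assoc]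

variable [∀ i, Fintype (S i)] [∀ i, Nonempty (S i)]

theorem sat_bigOr (s : EpState n S H) (i : Fin n) (si : S i) (l : List (Form n S)) :
    sat s (bigOr (falseAtom i si) l) ↔ ∃ g ∈ l, sat s g := by
  cases l with
  | nil =>
    simp only [bigOr, List.not_mem_nil, false_and, exists_false, iff_false]
    exact (s.val i _).1 si
  | cons a l => simp [bigOr, sat_foldl_or]

theorem sat_bigAnd (s : EpState n S H) (d : Form n S) (l : List (Form n S)) (hl : l ≠ []) :
    sat s (bigAnd d l) ↔ ∀ g ∈ l, sat s g := by
  cases l with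
  | nil => exact absurd rfl hl
  | cons a l => simp [bigAnd, sat_foldl_and]

theorem mem_stratList (i : Fin n) (x : S i) : x ∈ stratList i := by simp [stratList]
theorem mem_oppList (i : Fin n) (x : Opp S i) : x ∈ oppList i := by simp [oppList]
theorem mem_othersList (i : Fin n) (x : {j : Fin n // j ≠ i}) : x ∈ othersList i := by
  simp [othersList]
theorem mem_hyperList (i : Fin n) (x : {A : Set (Fin n) // i ∈ A ∧ A ∈ Hbar H}) :
    x ∈ hyperList H i := by simp [hyperList]
theorem mem_memOthersList (A : Set (Fin n)) (i : Fin n) (x : {j : Fin n // j ∈ A ∧ j ≠ i}) :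
    x ∈ memOthersList A i := by simp [memOthersList]

theorem sat_strat_opp (s : EpState n S H) (i : Fin n) (si : S i) (F : S i → Opp S i → Form n S) :
    sat s (bigOr (falseAtom i si) ((stratList i).map fun si' =>
      bigAnd (falseAtom i si) ((oppList i).map fun sOpp => F si' sOpp))) ↔
    ∃ si', ∀ sOpp, sat s (F si' sOpp) := by
  have hne : ∀ si', ((oppList i).map fun sOpp => F si' sOpp) ≠ [] := by
    intro si' h
    have := mem_oppList i (fun j _ => Classical.arbitrary (S j))
    rw [List.map_eq_nil_iff] at h
    rw [h] at this
    simp at this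
  rw [sat_bigOr]
  constructor
  · rintro ⟨g, hg, h⟩
    obtain ⟨si', _, rfl⟩ := List.mem_map.1 hg
    rw [sat_bigAnd _ _ _ (hne si')] at h
    exact ⟨si', fun o => h _ (List.mem_map.2 ⟨o, mem_oppList i o, rfl⟩)⟩
  · rintro ⟨si', h⟩
    refine ⟨_, List.mem_map.2 ⟨si', mem_stratList i si', rfl⟩, ?_⟩
    rw [sat_bigAnd _ _ _ (hne si')]
    intro g hg
    obtain ⟨o, _, rfl⟩ := List.mem_map.1 hg
    exact h o

theorem sat_domF_zero (s : EpState n S H) (i : Fin n) (si : S i) :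
    sat s (domF 0 i si) ↔ ∀ t : EpState n S H, simA {i} s t →
      ∃ si', ∀ sOpp, (⟨i, sOpp, si', si⟩ : Atom n S) ∈ t.V := by
  simp only [domF, sat]
  refine forall_congr' fun t => imp_congr_right fun _ => ?_
  exact sat_strat_opp t i si _

theorem sat_domF_succ (s : EpState n S H) (k : ℕ) (i : Fin n) (si : S i) :
    sat s (domF (k + 1) i si) ↔ ∀ t : EpState n S H, simA {i} s t →
      ∃ si', ∀ sOpp : Opp S i, (⟨i, sOpp, si', si⟩ : Atom n S) ∈ t.V ∨
        ∃ (j : Fin n) (hj : j ≠ i), sat t (domF k j (sOpp j hj)) := by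
  simp only [domF, sat]
  refine forall_congr' fun t => imp_congr_right fun _ => ?_
  rw [sat_strat_opp]
  refine exists_congr fun si' => forall_congr' fun o => ?_
  rw [sat_bigOr]
  constructor
  · rintro ⟨g, hg, h⟩
    rcases List.mem_cons.1 hg with rfl | hg
    · exact Or.inl h
    · obtain ⟨j, _, rfl⟩ := List.mem_map.1 hg
      exact Or.inr ⟨j.1, j.2, h⟩
  · rintro (h | ⟨j, hj, h⟩)
    · exact ⟨_, List.mem_cons_self, h⟩
    · exact ⟨_, List.mem_cons_of_mem _ (List.mem_map.2 ⟨⟨j, hj⟩, mem_othersList i _, rfl⟩), h⟩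

theorem sat_rhsF (s : EpState n S H) (k : ℕ) (i : Fin n) (si : S i) :
    sat s (rhsF H k i si) ↔ 
      ∃ si', ∀ sOpp : Opp S i,
        (∀ t : EpState n S H, simA {i} s t → (⟨i, sOpp, si', si⟩ : Atom n S) ∈ t.V) ∨
        ∃ A : Set (Fin n), i ∈ A ∧ A ∈ Hbar H ∧ ∃ (j : Fin n) (hj : j ≠ i), j ∈ A ∧
          ∀ t : EpState n S H, simA A s t → sat t (domF k j (sOpp j hj)) := by
  unfold rhsF
  rw [sat_strat_opp]
  refine exists_congr fun si' => forall_congr' fun o => ?_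
  simp only [sat]
  refine or_congr Iff.rfl ?_
  rw [sat_bigOr]
  constructor
  · rintro ⟨g, hg, h⟩
    obtain ⟨A, _, rfl⟩ := List.mem_map.1 hg
    rw [sat_bigOr] at h
    obtain ⟨g, hg, h⟩ := h
    obtain ⟨j, _, rfl⟩ := List.mem_map.1 hg
    exact ⟨A.1, A.2.1, A.2.2, j.1, j.2.2, j.2.1, h⟩
  · rintro ⟨A, hi, hA, j, hj, hjA, h⟩
    refine ⟨_, List.mem_map.2 ⟨⟨A, hi, hA⟩, mem_hyperList i _, rfl⟩, ?_⟩
    rw [sat_bigOr]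
    exact ⟨_, List.mem_map.2 ⟨⟨j, hjA, hj⟩, mem_memOthersList A i _, rfl⟩, h⟩

theorem not_sat_empty (s : EpState n S H) (hs : s.V = ∅) (k : ℕ) :
    ∀ (i : Fin n) (si : S i), ¬ sat s (domF k i si) := by
  induction k with
  | zero =>
    intro i si h
    rw [sat_domF_zero] at h
    obtain ⟨x, hx⟩ := h s (simA_refl (Set.mem_singleton i) s)
    have := hx (fun j _ => Classical.arbitrary (S j))
    rw [hs] at this
    exact this
  | succ k ih =>
    intro i si h
    rw [sat_domF_succ] at h
    obtain ⟨x, hx⟩ := h s (simA_refl (Set.mem_singleton i) s)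
    rcases hx (fun j _ => Classical.arbitrary (S j)) with h1 | ⟨j, hj, h1⟩
    · rw [hs] at h1
      exact h1
    · exact ih _ _ h1

end Aux

/-- For any `ℓ ≥ 1`, player `i`, `s_i ∈ S_i` and state `(V,M)`:
`(V,M) ⊨ dom^{ℓ+1}(s_i)` iff `(V,M)` satisfies the corresponding formula with the knowledge
pushed inside (here `ℓ = k+1`, `dom^{ℓ+1} = domF (k+1)` and `dom^ℓ = domF k`). -/
theorem sat_dom_succ_iff {n : ℕ} {S : Fin n → Type}
    (hn : 1 < n) [∀ i, Fintype (S i)] [∀ i, Nonempty (S i)]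
    (H : Set (Set (Fin n))) (hH : ∀ A ∈ H, A.Nonempty)
    (st : EpState n S H) (k : ℕ) (i : Fin n) (si : S i) :
    sat st (domF (k + 1) i si) ↔ sat st (rhsF H k i si) := by
  rw [sat_domF_succ, sat_rhsF]
  constructor
  · intro h
    obtain ⟨si', h⟩ := h (minSt i st) (.single ⟨i, rfl, simI_minSt i st⟩)
    refine ⟨si', fun o => ?_⟩
    rcases h o with h | ⟨j, hj, h⟩
    · exact Or.inl fun t ht => simA_single_atom ht h.1 rfl
    refine Or.inr ?_
    have hu : sat (minSt j (minSt i st)) (domF k j (o j hj)) := by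
      cases k with
      | zero =>
        rw [sat_domF_zero] at h ⊢
        exact fun t ht => h t (.head ⟨j, rfl, simI_minSt j _⟩ ht)
      | succ k =>
        rw [sat_domF_succ] at h ⊢
        exact fun t ht => h t (.head ⟨j, rfl, simI_minSt j _⟩ ht)
    by_cases hg : ∃ B ∈ H, i ∈ B ∧ j ∈ B
    · obtain ⟨B, hB, hiB, hjB⟩ := hg
      have hiA : i ∈ ⋂₀ {B | B ∈ H ∧ i ∈ B ∧ j ∈ B} := fun B hB => hB.2.1
      have hjA : j ∈ ⋂₀ {B | B ∈ H ∧ i ∈ B ∧ j ∈ B} := fun B hB => hB.2.2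
      refine ⟨⋂₀ {B | B ∈ H ∧ i ∈ B ∧ j ∈ B}, hiA,
        ⟨⟨i, hiA⟩, {B | B ∈ H ∧ i ∈ B ∧ j ∈ B}, fun B hB => hB.1, ⟨B, hB, hiB, hjB⟩, rfl⟩, j, hj, hjA, ?_⟩
      intro t ht
      have hmsg : ∀ m ∈ st.M, i ∈ m.grp → j ∈ m.grp → m ∈ t.M := fun m hm hi hj' =>
        simA_msg ht hm (fun x hx => hx m.grp ⟨(st.wf m hm).2.2, hi, hj'⟩)
      refine sat_mono _ ?_ ?_ hu
      · rintro ⟨p, o', b, w⟩ ha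
        refine aux_trans t.val ?_ (minmin_atom hj st ha)
        rintro x y ⟨m, hm, hi, hj', he⟩
        have := t.truthful m (hmsg m hm hi hj')
        rw [he] at this
        exact this
      · rintro m ⟨⟨hm, hi⟩, hj'⟩
        exact hmsg m hm hi hj'
    · refine absurd hu (not_sat_empty _ ?_ k j _)
      rw [Set.eq_empty_iff_forall_notMem]
      rintro ⟨p, o', b, w⟩ ha
      have hR : ∀ x y : S p, (∃ m ∈ st.M, i ∈ m.grp ∧ j ∈ m.grp ∧
          m.atom = ⟨p, o', x, y⟩) → False := by
        rintro x y ⟨m, hm, hi, hj', _⟩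
        exact hg ⟨m.grp, (st.wf m hm).2.2, hi, hj'⟩
      cases minmin_atom hj st ha with
      | single h1 => exact hR _ _ h1
      | tail _ h1 => exact hR _ _ h1
  · rintro ⟨si', h⟩ t ht
    refine ⟨si', fun o => ?_⟩
    rcases h o with h | ⟨A, hi, hA, j, hj, hjA, h⟩
    · exact Or.inl (h t ht)
    · exact Or.inr ⟨j, hj, h t (simA_mono (by simpa using hi) ht)⟩
end

section
/- For any formula φ of the positive epistemic language L^+ and any states (V,M) and (V',M') with (V,M) ⊆ (V',M'): if (V,M) ⊨ φ then (V',M') ⊨ φ. -/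
open scoped Classical

variable {n : ℕ} {S : Fin n → Type}

variable {n : ℕ} {S : Fin n → Type}

set_option linter.unusedSectionVars false

variable {n : ℕ} {S : Fin n → Type}

variable {H : Set (Set (Fin n))}

variable [∀ i, Fintype (S i)] [∀ i, Nonempty (S i)]

/-- State inclusion `(V,M) ⊆ (V',M')`: `V ⊆ V'` and each message of `M` occurs in `M'` with
the same sender and atom and a possibly larger group. -/
def StateLE {n : ℕ} {S : Fin n → Type} {H : Set (Set (Fin n))}
    (s t : EpState n S H) : Prop :=
  s.V ⊆ t.V ∧
    ∀ m ∈ s.M, ∃ m' ∈ t.M, m'.sender = m.sender ∧ m'.atom = m.atom ∧ m.grp ⊆ m'.grp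

theorem step_aux {n : ℕ} {S : Fin n → Type} {H : Set (Set (Fin n))} (i : Fin n)
    (s t t' : EpState n S H) (hle : StateLE s t) (h : simI i t t') :
    ∃ s' : EpState n S H, simI i s s' ∧ StateLE s' t' := by
  obtain ⟨hV, hM⟩ := hle
  obtain ⟨h1, h2⟩ := h
  have key : ∀ m ∈ s.M, i ∈ m.grp →
      ∃ m' ∈ t'.M, m'.sender = m.sender ∧ m'.atom = m.atom ∧ m.grp ⊆ m'.grp := by
    intro m hm hi
    obtain ⟨m', hm', e1, e2, e3⟩ := hM m hm
    have : m' ∈ {m ∈ t.M | i ∈ m.grp} := ⟨hm', e3 hi⟩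
    rw [h2] at this
    exact ⟨m', this.1, e1, e2, e3⟩
  refine ⟨⟨s.V ∩ t'.V, {m ∈ s.M | i ∈ m.grp}, ?_, ?_, ?_⟩, ⟨?_, ?_⟩, ?_, ?_⟩
  · intro j o
    refine ⟨fun x hx => (s.val j o).1 x hx.1, fun a b c hab hbc => ?_⟩
    exact ⟨(s.val j o).2 a b c hab.1 hbc.1, (t'.val j o).2 a b c hab.2 hbc.2⟩
  · exact fun m hm => s.wf m hm.1
  · intro m hm
    refine ⟨s.truthful m hm.1, ?_⟩
    obtain ⟨m', hm', -, e2, -⟩ := key m hm.1 hm.2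
    exact e2 ▸ t'.truthful m' hm'
  · ext a
    constructor
    · rintro ⟨ha, hi⟩
      have : a ∈ {a ∈ t.V | a.pl = i} := ⟨hV ha, hi⟩
      rw [h1] at this
      exact ⟨⟨ha, this.1⟩, hi⟩
    · rintro ⟨ha, hi⟩
      exact ⟨ha.1, hi⟩
  · ext m
    constructor
    · rintro ⟨ha, hi⟩
      exact ⟨⟨ha, hi⟩, hi⟩
    · rintro ⟨ha, hi⟩
      exact ⟨ha.1, hi⟩
  · exact fun a ha => ha.2
  · exact fun m hm => key m hm.1 hm.2

theorem simA_aux {n : ℕ} {S : Fin n → Type} {H : Set (Set (Fin n))} (A : Set (Fin n))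
    (s t t' : EpState n S H) (hle : StateLE s t) (h : simA A t t') :
    ∃ s' : EpState n S H, simA A s s' ∧ StateLE s' t' := by
  unfold simA at *
  induction h with
  | single h =>
    obtain ⟨i, hi, h⟩ := h
    obtain ⟨s', h1, h2⟩ := step_aux i _ _ _ hle h
    exact ⟨s', .single ⟨i, hi, h1⟩, h2⟩
  | tail _ h ih =>
    obtain ⟨u, hu, hle'⟩ := ih
    obtain ⟨i, hi, h⟩ := h
    obtain ⟨s', h1, h2⟩ := step_aux i _ _ _ hle' h
    exact ⟨s', hu.tail ⟨i, hi, h1⟩, h2⟩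

/-- Formulas of the positive language `L⁺` are preserved under state
inclusion. -/
theorem sat_mono_of_stateLE {n : ℕ} {S : Fin n → Type}
    (hn : 1 < n) [∀ i, Fintype (S i)] [∀ i, Nonempty (S i)]
    (H : Set (Set (Fin n))) (hH : ∀ A ∈ H, A.Nonempty)
    (s t : EpState n S H) (hle : StateLE s t) (φ : Form n S)
    (hsat : sat s φ) : sat t φ := by
  induction φ generalizing s t with
  | atom a => exact hle.1 hsat
  | and f g ihf ihg => exact ⟨ihf s t hle hsat.1, ihg s t hle hsat.2⟩
  | or f g ihf ihg => exact hsat.imp (ihf s t hle) (ihg s t hle)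
  | ck A f ih =>
    intro t' ht'
    obtain ⟨s', h1, h2⟩ := simA_aux A s t t' hle ht'
    exact ih s' t' h2 (hsat s' h1)
end

section
/- For any formulas φ₁, φ₂ of the positive epistemic language L^+, any state (V,M) and any nonempty group A ⊆ N: (V,M) ⊨ C_A(φ₁ ∨ φ₂) if and only if (V,M) ⊨ C_A φ₁ ∨ C_A φ₂. -/
open scoped Classical

variable {n : ℕ} {S : Fin n → Type}

variable {n : ℕ} {S : Fin n → Type}

set_option linter.unusedSectionVars false

variable {n : ℕ} {S : Fin n → Type}

variable {H : Set (Set (Fin n))}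

variable [∀ i, Fintype (S i)] [∀ i, Nonempty (S i)]

def StLE (s t : EpState n S H) : Prop := s.V ⊆ t.V ∧ s.M ⊆ t.M

theorem simI_refl' (i : Fin n) (s : EpState n S H) : simI i s s := ⟨rfl, rfl⟩

theorem simA_symm' (A : Set (Fin n)) {s t : EpState n S H} (h : simA A s t) : simA A t s := by
  have flip : ∀ {x y : EpState n S H}, (∃ i ∈ A, simI i x y) → ∃ i ∈ A, simI i y x := by
    rintro x y ⟨i, hi, h1, h2⟩
    exact ⟨i, hi, h1.symm, h2.symm⟩
  induction h with
  | single h => exact .single (flip h)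
  | tail _ h ih => exact .head (flip h) ih

theorem simI_V {i : Fin n} {s t : EpState n S H} (h : simI i s t) {a : Atom n S}
    (ha : a.pl = i) : a ∈ s.V ↔ a ∈ t.V := by
  have := Set.ext_iff.1 h.1 a
  simpa [ha] using this

theorem simI_M {i : Fin n} {s t : EpState n S H} (h : simI i s t) {m : Msg n S}
    (hm : i ∈ m.grp) : m ∈ s.M ↔ m ∈ t.M := by
  have := Set.ext_iff.1 h.2 m
  simpa [hm] using this

/-- Glue `i`'s information in `s` with the others' preferences in `t`. -/
theorem step_back {i : Fin n} {s s' t' : EpState n S H} (hle : StLE s s') (h : simI i s' t') :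
    ∃ t, simI i s t ∧ StLE t t' := by
  refine ⟨⟨{a | (a.pl = i ∧ a ∈ s.V) ∨ (a.pl ≠ i ∧ a ∈ t'.V)}, {m ∈ s.M | i ∈ m.grp},
    ?_, fun m hm => s.wf m hm.1, ?_⟩, ⟨?_, ?_⟩, ?_, ?_⟩
  · intro k o
    have h1 := s.val k o
    have h2 := t'.val k o
    by_cases hk : k = i
    · simpa [hk] using h1
    · simpa [hk] using h2
  · intro m hm
    by_cases hk : m.atom.pl = i
    · exact Or.inl ⟨hk, s.truthful m hm.1⟩
    · exact Or.inr ⟨hk, t'.truthful m ((simI_M h hm.2).1 (hle.2 hm.1))⟩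
  · ext a
    simp only [Set.mem_setOf_eq]
    tauto
  · ext m
    simp only [Set.mem_setOf_eq]
    tauto
  · rintro a (⟨h1, h2⟩ | ⟨h1, h2⟩)
    · exact (simI_V h h1).1 (hle.1 h2)
    · exact h2
  · intro m hm
    exact (simI_M h hm.2).1 (hle.2 hm.1)

theorem chain_back {A : Set (Fin n)} {s s' t' : EpState n S H} (hle : StLE s s')
    (h : simA A s' t') : ∃ t, simA A s t ∧ StLE t t' := by
  induction h with
  | single h =>
    obtain ⟨i, hi, h⟩ := h
    obtain ⟨t, h1, h2⟩ := step_back hle h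
    exact ⟨t, .single ⟨i, hi, h1⟩, h2⟩
  | tail _ h ih =>
    obtain ⟨u, hu, hule⟩ := ih
    obtain ⟨i, hi, h⟩ := h
    obtain ⟨t, h1, h2⟩ := step_back hule h
    exact ⟨t, .tail hu ⟨i, hi, h1⟩, h2⟩

theorem sat_mono_s14 (φ : Form n S) : ∀ {s t : EpState n S H}, StLE s t → sat s φ → sat t φ := by
  induction φ with
  | atom a => intro s t h hs; exact h.1 hs
  | and f g ihf ihg => intro s t h hs; exact ⟨ihf h hs.1, ihg h hs.2⟩
  | or f g ihf ihg => intro s t h hs; exact hs.imp (ihf h) (ihg h)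
  | ck A f ih =>
    intro s t h hs t' ht'
    obtain ⟨u, hu, hle⟩ := chain_back h ht'
    exact ih hle (hs u hu)

/-- Keep only what player `i` can be certain of. -/
def down (i : Fin n) (s : EpState n S H) : EpState n S H where
  V := {a ∈ s.V | a.pl = i ∨ ∀ W : Set (Atom n S), IsValuation W →
    (∀ m ∈ s.M, i ∈ m.grp → m.atom ∈ W) → a ∈ W}
  M := {m ∈ s.M | i ∈ m.grp}
  val := by
    intro k o
    refine ⟨fun x hx => (s.val k o).1 x hx.1, fun a b c hab hbc =>
      ⟨(s.val k o).2 a b c hab.1 hbc.1, ?_⟩⟩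
    rcases hab.2 with h | h
    · exact Or.inl h
    rcases hbc.2 with h' | h'
    · exact Or.inl h'
    exact Or.inr fun W hW hm => (hW k o).2 a b c (h W hW hm) (h' W hW hm)
  wf := fun m hm => s.wf m hm.1
  truthful := fun m hm => ⟨s.truthful m hm.1, Or.inr fun _ _ h => h m hm.1 hm.2⟩

theorem down_simI (i : Fin n) (s : EpState n S H) : simI i s (down i s) := by
  constructor
  · ext a
    simp only [down, Set.mem_setOf_eq]
    tauto
  · ext m
    simp only [down, Set.mem_setOf_eq]
    tauto

theorem fixed_le {A : Set (Fin n)} {u t : EpState n S H}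
    (hu : ∀ i ∈ A, StLE u (down i u)) (h : simA A u t) : StLE u t := by
  have step : ∀ v w : EpState n S H, StLE u v → (∃ i ∈ A, simI i v w) → StLE u w := by
    rintro v w hv ⟨i, hi, h⟩
    have hM : u.M ⊆ w.M := fun m hm => (simI_M h ((hu i hi).2 hm).2).1 (hv.2 hm)
    refine ⟨fun a ha => ?_, hM⟩
    rcases ((hu i hi).1 ha).2 with h' | h'
    · exact (simI_V h h').1 (hv.1 ha)
    · exact h' w.V w.val fun m hm _ => w.truthful m (hM hm)
  induction h with
  | single h => exact step u _ ⟨subset_rfl, subset_rfl⟩ h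
  | tail _ h ih => exact step _ _ ih h

theorem finite_atom' : Finite (Atom n S) := by
  refine Finite.of_injective
    (fun a : Atom n S => (⟨a.pl, a.opp, a.better, a.worse⟩ :
      Σ i : Fin n, Opp S i × S i × S i)) ?_
  rintro ⟨i, o, b, w⟩ ⟨i', o', b', w'⟩ h
  simp only [Sigma.mk.injEq] at h
  obtain ⟨rfl, h⟩ := h
  simp only [heq_eq_eq, Prod.mk.injEq] at h
  obtain ⟨rfl, rfl, rfl⟩ := h
  rfl

theorem finite_msg' : Finite (Msg n S) := by
  haveI : Finite (Atom n S) := finite_atom'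
  refine Finite.of_injective
    (fun m : Msg n S => ((m.sender, m.grp, m.atom) : Fin n × Set (Fin n) × Atom n S)) ?_
  rintro ⟨i, o, b⟩ ⟨i', o', b'⟩ h
  simp only [Prod.mk.injEq] at h
  obtain ⟨rfl, rfl, rfl⟩ := h
  rfl

theorem exists_fixed (A : Set (Fin n)) (hA : A.Nonempty) (st : EpState n S H) :
    ∃ u, simA A st u ∧ ∀ i ∈ A, StLE u (down i u) := by
  haveI : Finite (Atom n S) := finite_atom'
  haveI : Finite (Msg n S) := finite_msg'
  obtain ⟨i0, hi0⟩ := hA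
  have wf : WellFounded (fun x y : Set (Atom n S) × Set (Msg n S) => x < y) :=
    (Finite.to_wellFoundedLT).wf
  have wf' := InvImage.wf (fun s : EpState n S H => (s.V, s.M)) wf
  obtain ⟨u, hu, hmin⟩ := wf'.has_min {u | simA A st u}
    ⟨st, .single ⟨i0, hi0, simI_refl' _ _⟩⟩
  refine ⟨u, hu, fun i hi => ?_⟩
  have h1 : simA A st (down i u) := Relation.TransGen.tail hu ⟨i, hi, down_simI i u⟩
  have h2 := hmin _ h1
  by_contra hc
  apply h2
  refine lt_of_le_not_ge ⟨fun a ha => ha.1, fun m hm => hm.1⟩ fun hle => hc ⟨hle.1, hle.2⟩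

/-- Common knowledge distributes over disjunction in `L⁺`:
`(V,M) ⊨ C_A(φ₁ ∨ φ₂)` iff `(V,M) ⊨ C_A φ₁ ∨ C_A φ₂`. -/
theorem sat_ck_or_iff {n : ℕ} {S : Fin n → Type}
    (hn : 1 < n) [∀ i, Fintype (S i)] [∀ i, Nonempty (S i)]
    (H : Set (Set (Fin n))) (hH : ∀ A ∈ H, A.Nonempty)
    (st : EpState n S H) (A : Set (Fin n)) (hA : A.Nonempty) (φ₁ φ₂ : Form n S) :
    sat st (.ck A (.or φ₁ φ₂)) ↔ sat st (.or (.ck A φ₁) (.ck A φ₂)) := by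
  constructor
  · intro h
    obtain ⟨u, hu, hfix⟩ := exists_fixed A hA st
    have key : ∀ t, simA A st t → StLE u t := fun t ht =>
      fixed_le hfix ((simA_symm' A hu).trans ht)
    rcases h u hu with h1 | h1
    · exact Or.inl fun t ht => sat_mono_s14 φ₁ (key t ht) h1
    · exact Or.inr fun t ht => sat_mono_s14 φ₂ (key t ht) h1
  · rintro (h | h) t ht
    · exact Or.inl (h t ht)
    · exact Or.inr (h t ht)
end

section
/- For any group A ⊆ N with |A| ≥ 2, any atom p ∈ At, and any state (V,M), the following are equivalent: (i) M↾_A ⊨ p (p is entailed by the messages in M received by A); (ii) (V,M) ⊨ C_A p. -/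
open scoped Classical

variable {n : ℕ} {S : Fin n → Type}

variable {n : ℕ} {S : Fin n → Type}

set_option linter.unusedSectionVars false

variable {n : ℕ} {S : Fin n → Type}

variable {H : Set (Set (Fin n))}

variable [∀ i, Fintype (S i)] [∀ i, Nonempty (S i)]

/-- The messages addressed to supersets of `F`, keeping the valuation. -/
def rmState {n : ℕ} {S : Fin n → Type} {H : Set (Set (Fin n))} (st : EpState n S H)
    (F : Set (Fin n)) : EpState n S H :=
  ⟨st.V, {m ∈ st.M | F ⊆ m.grp}, st.val, fun m hm => st.wf m hm.1,
    fun m hm => st.truthful m hm.1⟩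

theorem entails_mem_V {n : ℕ} {S : Fin n → Type} {H : Set (Set (Fin n))} (st : EpState n S H)
    (A : Set (Fin n)) (i : Fin n) (o : Opp S i) (x y : S i) (h : entails st.M A o x y) :
    (⟨i, o, x, y⟩ : Atom n S) ∈ st.V := by
  unfold entails at h
  induction h with
  | single h =>
    obtain ⟨m, hm, _, e⟩ := h
    exact e ▸ st.truthful m hm
  | tail _ h ih =>
    obtain ⟨m, hm, _, e⟩ := h
    exact (st.val i o).2 _ _ _ ih (e ▸ st.truthful m hm)

theorem simA_msgs {n : ℕ} {S : Fin n → Type} {H : Set (Set (Fin n))} (A : Set (Fin n))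
    (s t : EpState n S H) (h : simA A s t) (m : Msg n S) (hA : A ⊆ m.grp) (hm : m ∈ s.M) :
    m ∈ t.M := by
  unfold simA at h
  induction h with
  | single h =>
    obtain ⟨i, hi, hs⟩ := h
    exact ((Set.ext_iff.1 hs.2 m).1 ⟨hm, hA hi⟩).1
  | tail _ h ih =>
    obtain ⟨i, hi, hs⟩ := h
    exact ((Set.ext_iff.1 hs.2 m).1 ⟨ih, hA hi⟩).1

theorem reach_rm {n : ℕ} {S : Fin n → Type} {H : Set (Set (Fin n))} (A : Set (Fin n))
    (st : EpState n S H) (F : Finset (Fin n)) (hF : (F : Set (Fin n)) ⊆ A) :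
    Relation.ReflTransGen (fun s t : EpState n S H => ∃ i ∈ A, simI i s t) st
      (rmState st (F : Set (Fin n))) := by
  induction F using Finset.induction_on with
  | empty =>
    have : rmState st ((∅ : Finset (Fin n)) : Set (Fin n)) = st := by
      cases st; simp [rmState]
    rw [this]
  | insert a F _ ih =>
    rw [Finset.coe_insert] at hF ⊢
    rw [Set.insert_subset_iff] at hF
    refine (ih hF.2).tail ⟨a, hF.1, rfl, ?_⟩
    ext m
    simp only [rmState, Set.mem_ofPred_eq, Set.insert_subset_iff]
    tauto

/-- For `|A| ≥ 2`, an atom `p` and a state `(V,M)`: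
`M↾_A ⊨ p` iff `(V,M) ⊨ C_A p`. -/
theorem entails_iff_sat_ck_atom {n : ℕ} {S : Fin n → Type}
    (hn : 1 < n) [∀ i, Fintype (S i)] [∀ i, Nonempty (S i)]
    (H : Set (Set (Fin n))) (hH : ∀ A ∈ H, A.Nonempty)
    (st : EpState n S H) (A : Set (Fin n)) (hA : 2 ≤ A.ncard) (p : Atom n S) :
    entails st.M A p.opp p.better p.worse ↔ sat st (.ck A (.atom p)) := by
  constructor
  · intro h t ht
    have h2 : entails t.M A p.opp p.better p.worse := by
      refine Relation.TransGen.mono ?_ _ _ h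
      rintro a b ⟨m, hm, hs, e⟩
      exact ⟨m, simA_msgs A st t ht m hs hm, hs, e⟩
    exact entails_mem_V t A _ _ _ _ h2
  · intro h
    obtain ⟨j, hjA, hj⟩ : ∃ j ∈ A, j ≠ p.pl :=
      Set.exists_ne_of_one_lt_ncard (by omega) p.pl
    let t : EpState n S H :=
      { V := {a | a ∈ st.V ∧ (a.pl = j ∨ entails st.M A a.opp a.better a.worse)}
        M := {m ∈ st.M | A ⊆ m.grp}
        val := by
          intro i o
          refine ⟨fun s hs => (st.val i o).1 s hs.1, ?_⟩
          rintro a b c ⟨h1, h2⟩ ⟨h3, h4⟩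
          refine ⟨(st.val i o).2 a b c h1 h3, ?_⟩
          rcases h2 with h2 | h2
          · exact Or.inl h2
          · rcases h4 with h4 | h4
            · exact Or.inl h4
            · exact Or.inr (Relation.TransGen.trans h2 h4)
        wf := fun m hm => st.wf m hm.1
        truthful := fun m hm => ⟨st.truthful m hm.1,
          Or.inr (Relation.TransGen.single ⟨m, hm.1, hm.2, rfl⟩)⟩ }
    have hr := reach_rm A st A.toFinset (by simp)
    rw [Set.coe_toFinset] at hr
    have hst : simA A st t := by
      refine Relation.TransGen.tail' hr ⟨j, hjA, ?_, rfl⟩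
      ext a
      simp only [rmState, t, Set.mem_ofPred_eq]
      tauto
    have hp : p ∈ t.V := h t hst
    rcases hp.2 with h1 | h1
    · exact absurd h1.symm hj
    · exact h1
end
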